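/- arXiv:2412.15142 — 14 statements merged into one kernel-verified Lean document; each statement's English description precedes it below -/
import Mathlib

section
/- Let F : E → E satisfy the forward Euler condition with constant Δt_FE > 0. Let s ≥ 1 and let real coefficients α_{i,j} ≥ 0 and β_{i,j} ≥ 0 (for 1 ≤ i ≤ s, 0 ≤ j ≤ i−1) satisfy the consistency condition Σ_{j=0}^{i−1} α_{i,j} = 1 for every i, and β_{i,j} = 0 whenever α_{i,j} = 0. Then for every u⁰ ∈ E and every Δt ≥ 0 such that Δt·β_{i,j} ≤ Δt_FE·α_{i,j} for all i, j, the stages defined recursively by y⁽⁰⁾ = u⁰ and y⁽ⁱ⁾ = Σ_{j=0}^{i−1} ( α_{i,j}·y⁽ʲ⁾ + Δt·β_{i,j}·F(y⁽ʲ⁾) ) satisfy ‖y⁽ⁱ⁾‖ ≤ ‖u⁰‖ for every i = 1, …, s; in particular the Runge–Kutta update u¹ = y⁽ˢ⁾ satisfies ‖u¹‖ ≤ ‖u⁰‖. -/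
/-- If `0 ≤ b ≤ h₀ * a`, then `a • u + b • F u` is `a` times a
forward Euler step, so its seminorm is at most `a * ‖u‖`. -/
theorem Seminorm.smul_add_smul_le_of_forwardEuler
    {E : Type*} [AddCommGroup E] [Module ℝ E] (p : Seminorm ℝ E) {F : E → E} {h₀ a b : ℝ} {u : E}
    (hF : ∀ h : ℝ, 0 ≤ h → h ≤ h₀ → p (u + h • F u) ≤ p u)
    (ha : 0 ≤ a) (hb : 0 ≤ b) (hab : b ≤ h₀ * a) :
    p (a • u + b • F u) ≤ a * p u := by
  rcases ha.eq_or_lt with rfl | ha'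
  · obtain rfl : b = 0 := le_antisymm (by simpa using hab) hb
    simp
  · have hfactor : a • u + b • F u = a • (u + (b / a) • F u) := by
      rw [smul_add, smul_smul, mul_div_cancel₀ _ ha'.ne']
    rw [hfactor, map_smul_eq_mul, Real.norm_of_nonneg ha]
    exact mul_le_mul_of_nonneg_left
      (hF _ (div_nonneg hb ha) ((div_le_iff₀ ha').2 hab)) ha

/-- Explicit SSP Runge--Kutta methods written in Shu--Osher
(convex combination of forward Euler) form preserve the strong stability
property of forward Euler under the time-step restriction
`Δt·β_{i,j} ≤ Δt_FE·α_{i,j}`. -/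
theorem ssp_shu_osher_explicit_rk
    {E : Type*} [AddCommGroup E] [Module ℝ E] (Nrm : Seminorm ℝ E)
    (F : E → E) (dtFE : ℝ) (hdtFE : 0 < dtFE)
    (hFE : ∀ u : E, ∀ h : ℝ, 0 ≤ h → h ≤ dtFE → Nrm (u + h • F u) ≤ Nrm u)
    (s : ℕ) (hs : 1 ≤ s) (α β : ℕ → ℕ → ℝ)
    (hα : ∀ i j, 1 ≤ i → i ≤ s → j < i → 0 ≤ α i j)
    (hβ : ∀ i j, 1 ≤ i → i ≤ s → j < i → 0 ≤ β i j)
    (hcons : ∀ i, 1 ≤ i → i ≤ s → ∑ j ∈ Finset.range i, α i j = 1)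
    (hzero : ∀ i j, 1 ≤ i → i ≤ s → j < i → α i j = 0 → β i j = 0)
    (u0 : E) (Δt : ℝ) (hΔt : 0 ≤ Δt)
    (hstep : ∀ i j, 1 ≤ i → i ≤ s → j < i → Δt * β i j ≤ dtFE * α i j)
    (y : ℕ → E) (hy0 : y 0 = u0)
    (hy : ∀ i, 1 ≤ i → i ≤ s →
      y i = ∑ j ∈ Finset.range i, (α i j • y j + (Δt * β i j) • F (y j))) :
    (∀ i, 1 ≤ i → i ≤ s → Nrm (y i) ≤ Nrm u0) ∧ Nrm (y s) ≤ Nrm u0 := by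
  have stage_le : ∀ i ≤ s, Nrm (y i) ≤ Nrm u0 := by
    intro i
    induction i using Nat.strong_induction_on with
    | _ i ih =>
      intro his
      rcases Nat.eq_zero_or_pos i with rfl | hi
      · rw [hy0]
      · rw [hy i hi his]
        calc Nrm (∑ j ∈ Finset.range i, (α i j • y j + (Δt * β i j) • F (y j)))
            ≤ ∑ j ∈ Finset.range i, Nrm (α i j • y j + (Δt * β i j) • F (y j)) :=
              Finset.le_sum_of_subadditive Nrm (map_zero Nrm).le (map_add_le_add Nrm) _ _
          _ ≤ ∑ j ∈ Finset.range i, α i j * Nrm u0 := by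
              refine Finset.sum_le_sum fun j hj => ?_
              have hji := Finset.mem_range.1 hj
              have hαij := hα i j hi his hji
              exact (Nrm.smul_add_smul_le_of_forwardEuler (hFE (y j)) hαij
                (mul_nonneg hΔt (hβ i j hi his hji)) (hstep i j hi his hji)).trans
                (mul_le_mul_of_nonneg_left (ih j hji (hji.le.trans his)) hαij)
          _ = Nrm u0 := by rw [← Finset.sum_mul, hcons i hi his, one_mul]
  exact ⟨fun i _ his => stage_le i his, stage_le s le_rfl⟩
end

section
/- Let s ≥ 1, let A, Ȧ be s×s real matrices, b, ḃ ∈ ℝˢ, and define the (s+1)×(s+1) matrices S = [[A, 0],[bᵀ, 0]] and Ṡ = [[Ȧ, 0],[ḃᵀ, 0]]. Suppose r > 0 and K > 0 are such that the matrix M = I + r·S + (r²/K²)·Ṡ is invertible and the entrywise inequalities M⁻¹·e ≥ 0 (where e is the all-ones vector), r·M⁻¹·S ≥ 0, and (r²/K²)·M⁻¹·Ṡ ≥ 0 hold. Let F : E → E satisfy the forward Euler condition with constant Δt_FE > 0 and let Ḟ : E → E satisfy the second derivative condition with constant K·Δt_FE. Then for every u⁰ ∈ E, every Δt with 0 ≤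 Δt ≤ r·Δt_FE, and every family y₁, …, y_{s+1} ∈ E satisfying the stage equations y_i = u⁰ + Δt·Σ_{j=1}^{s+1} S_{ij}·F(y_j) + Δt²·Σ_{j=1}^{s+1} Ṡ_{ij}·Ḟ(y_j), the update u¹ = y_{s+1} satisfies ‖u¹‖ ≤ ‖u⁰‖. -/
open Matrix

/-- The `(s+1)×(s+1)` matrix `[[A, 0],[bᵀ, 0]]` built from an `s×s` matrix `A`
and a vector `b ∈ ℝˢ`. -/
def borderMat {s : ℕ} (A : Matrix (Fin s) (Fin s) ℝ) (b : Fin s → ℝ) :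
    Matrix (Fin (s + 1)) (Fin (s + 1)) ℝ :=
  Matrix.of fun i j =>
    if hj : (j : ℕ) < s then
      if hi : (i : ℕ) < s then A ⟨i, hi⟩ ⟨j, hj⟩ else b ⟨j, hj⟩
    else 0

/-- The matrix `M = I + r·S + (r²/K²)·Ṡ`. -/
noncomputable def sspMatSD {s : ℕ} (A Adot : Matrix (Fin s) (Fin s) ℝ)
    (b bdot : Fin s → ℝ) (r K : ℝ) : Matrix (Fin (s + 1)) (Fin (s + 1)) ℝ :=
  1 + r • borderMat A b + (r ^ 2 / K ^ 2) • borderMat Adot bdot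

open Filter Topology

/-- If `z ≤ T z` for an entrywise nonnegative matrix `T` with row sums at most one, and `1` is not
an eigenvalue of `T`, then `z ≤ 0`. -/
theorem Matrix.nonpos_of_le_mulVec {n : Type*} [Fintype n] (T : Matrix n n ℝ)
    (hT : ∀ i j, 0 ≤ T i j) (hrow : T *ᵥ (fun _ => 1) ≤ fun _ => 1)
    (hfix : ∀ w, T *ᵥ w = w → w = 0) {z : n → ℝ} (hz : z ≤ T *ᵥ z) : z ≤ 0 := by
  have hmono : Monotone (fun v : n → ℝ => T *ᵥ v) := fun v w hvw i =>
    Finset.sum_le_sum fun j _ => mul_le_mul_of_nonneg_left (hvw j) (hT i j)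
  have hseq : Monotone fun k => (fun v : n → ℝ => T *ᵥ v)^[k] z :=
    hmono.monotone_iterate_of_le_map hz
  set c : ℝ := ∑ j, |z j|
  have hc : 0 ≤ c := Finset.sum_nonneg fun j _ => abs_nonneg _
  have hconst : T *ᵥ (fun _ => c) ≤ fun _ => c := fun i => by
    have h := mul_le_mul_of_nonneg_right (hrow i) hc
    simpa [mulVec, dotProduct, Finset.sum_mul] using h
  have hbound : ∀ k, (fun v : n → ℝ => T *ᵥ v)^[k] z ≤ fun _ => c := fun k => by
    induction k with
    | zero =>
      exact fun i => (le_abs_self _).trans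
        (Finset.single_le_sum (f := fun j => |z j|) (fun j _ => abs_nonneg _) (Finset.mem_univ i))
    | succ k ih =>
      rw [Function.iterate_succ_apply']
      exact (hmono ih).trans hconst
  have hlim : Tendsto (fun k => (fun v : n → ℝ => T *ᵥ v)^[k] z) atTop
      (𝓝 fun i => ⨆ k, (fun v : n → ℝ => T *ᵥ v)^[k] z i) :=
    tendsto_pi_nhds.2 fun i => tendsto_atTop_ciSup (fun k l hkl => hseq hkl i)
      ⟨c, by rintro _ ⟨k, rfl⟩; exact hbound k i⟩
  have hw := hfix _ (isFixedPt_of_tendsto_iterate hlim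
    (Continuous.matrix_mulVec continuous_const continuous_id).continuousAt)
  rw [hw] at hlim
  exact hseq.ge_of_tendsto hlim 0

theorem Matrix.sum_smul_sum_smul {l m n R E : Type*} [Fintype m] [Fintype n] [Semiring R]
    [AddCommMonoid E] [Module R E] (B : Matrix l m R) (C : Matrix m n R) (v : n → E) (i : l) :
    ∑ k, B i k • ∑ j, C k j • v j = ∑ j, (B * C) i j • v j := by
  simp_rw [Finset.smul_sum, smul_smul, mul_apply, Finset.sum_smul]
  exact Finset.sum_comm

theorem Seminorm.sum_smul_le {ι E : Type*} [Fintype ι] [AddCommGroup E] [Module ℝ E]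
    (p : Seminorm ℝ E) {a : ι → ℝ} (ha : ∀ j, 0 ≤ a j) {v : ι → E} {x : ι → ℝ}
    (hv : ∀ j, p (v j) ≤ x j) : p (∑ j, a j • v j) ≤ ∑ j, a j * x j := by
  refine (Finset.le_sum_of_subadditive p (map_zero p).le (map_add_le_add p) _ _).trans
    (Finset.sum_le_sum fun j _ => ?_)
  rw [map_smul_eq_mul, Real.norm_of_nonneg (ha j)]
  exact mul_le_mul_of_nonneg_left (hv j) (ha j)

/-- Sufficient conditions for a two-derivative multistage method
to preserve the strong stability properties of the forward Euler condition and
the second derivative condition (Theorem thmSD). -/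
theorem ssp_two_derivative_rk_second_derivative_condition
    {E : Type*} [AddCommGroup E] [Module ℝ E] (Nrm : Seminorm ℝ E)
    (s : ℕ) (hs : 1 ≤ s)
    (A Adot : Matrix (Fin s) (Fin s) ℝ) (b bdot : Fin s → ℝ)
    (r K dtFE : ℝ) (hr : 0 < r) (hK : 0 < K) (hdtFE : 0 < dtFE)
    (hMinv : IsUnit (sspMatSD A Adot b bdot r K))
    (hcond1 : ∀ i, 0 ≤ ((sspMatSD A Adot b bdot r K)⁻¹ *ᵥ (fun _ => 1)) i)
    (hcond2 : ∀ i j,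
      0 ≤ r * (((sspMatSD A Adot b bdot r K)⁻¹ * borderMat A b) i j))
    (hcond3 : ∀ i j,
      0 ≤ (r ^ 2 / K ^ 2) *
        (((sspMatSD A Adot b bdot r K)⁻¹ * borderMat Adot bdot) i j))
    (F Fdot : E → E)
    (hFE : ∀ u : E, ∀ h : ℝ, 0 ≤ h → h ≤ dtFE → Nrm (u + h • F u) ≤ Nrm u)
    (hSD : ∀ u : E, ∀ h : ℝ, 0 ≤ h → h ≤ K * dtFE →
      Nrm (u + h ^ 2 • Fdot u) ≤ Nrm u)
    (u0 : E) (Δt : ℝ) (hΔt0 : 0 ≤ Δt) (hΔt : Δt ≤ r * dtFE)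
    (y : Fin (s + 1) → E)
    (hy : ∀ i, y i = u0 + Δt • (∑ j, borderMat A b i j • F (y j))
        + Δt ^ 2 • (∑ j, borderMat Adot bdot i j • Fdot (y j))) :
    Nrm (y (Fin.last s)) ≤ Nrm u0 := by
  set S := borderMat A b
  set D := borderMat Adot bdot
  set M := sspMatSD A Adot b bdot r K
  set q := r ^ 2 / K ^ 2 with hq
  have hMdef : M = 1 + r • S + q • D := rfl
  have hinv : M⁻¹ * M = 1 := nonsing_inv_mul M ((isUnit_iff_isUnit_det M).1 hMinv)
  have hinv' : M * M⁻¹ = 1 := mul_nonsing_inv M ((isUnit_iff_isUnit_det M).1 hMinv)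
  set P := M⁻¹ * (r • S) with hP
  set Q := M⁻¹ * (q • D) with hQ
  have hPnn : ∀ i j, 0 ≤ P i j := fun i j => by simpa [hP] using hcond2 i j
  have hQnn : ∀ i j, 0 ≤ Q i j := fun i j => by simpa [hQ] using hcond3 i j
  have hsum : M⁻¹ + (P + Q) = 1 := by
    calc M⁻¹ + (P + Q) = M⁻¹ * (1 + r • S + q • D) := by
          rw [hP, hQ, mul_add, mul_add, mul_one, add_assoc]
      _ = 1 := hinv
  have hPQ : P + Q = 1 - M⁻¹ := eq_sub_of_add_eq' hsum
  let a : Fin (s + 1) → E := fun j => y j + (Δt / r) • F (y j)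
  let d : Fin (s + 1) → E := fun j => y j + (Δt / r * K) ^ 2 • Fdot (y j)
  have ha : ∀ j, Nrm (a j) ≤ Nrm (y j) := fun j =>
    hFE _ _ (by positivity) ((div_le_iff₀ hr).2 (by linarith))
  have hd : ∀ j, Nrm (d j) ≤ Nrm (y j) := fun j =>
    hSD _ _ (by positivity) (by
      rw [mul_comm K]
      exact mul_le_mul_of_nonneg_right ((div_le_iff₀ hr).2 (by linarith)) hK.le)
  have hMy : ∀ i, ∑ j, M i j • y j =
      u0 + ∑ j, (r • S) i j • a j + ∑ j, (q • D) i j • d j := fun i => by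
    have h1 : ∑ j, M i j • y j
        = y i + ∑ j, (r • S) i j • y j + ∑ j, (q • D) i j • y j := by
      simp [hMdef, add_smul, Finset.sum_add_distrib, one_apply]
    have h2 : ∑ j, (r • S) i j • a j = ∑ j, (r • S) i j • y j + Δt • ∑ j, S i j • F (y j) := by
      rw [Finset.smul_sum, ← Finset.sum_add_distrib]
      refine Finset.sum_congr rfl fun j _ => ?_
      simp only [a, smul_add, smul_smul, Matrix.smul_apply, smul_eq_mul]
      congr 2
      field_simp
    have h3 : ∑ j, (q • D) i j • d j
        = ∑ j, (q • D) i j • y j + Δt ^ 2 • ∑ j, D i j • Fdot (y j) := by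
      rw [Finset.smul_sum, ← Finset.sum_add_distrib]
      refine Finset.sum_congr rfl fun j _ => ?_
      simp only [d, smul_add, smul_smul, Matrix.smul_apply, smul_eq_mul]
      congr 2
      rw [hq]
      field_simp
    rw [h1, h2, h3]
    nth_rewrite 1 [hy i]
    abel
  have hrep : ∀ i, y i = (M⁻¹ *ᵥ fun _ => 1) i • u0 + ∑ j, P i j • a j + ∑ j, Q i j • d j :=
    fun i => by
      have h := sum_smul_sum_smul M⁻¹ M y i
      simp only [hinv, hMy, smul_add, Finset.sum_add_distrib, sum_smul_sum_smul] at h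
      rw [← Finset.sum_smul] at h
      simpa [hP, hQ, one_apply, mulVec, dotProduct] using h.symm
  have hle : (fun i => Nrm (y i) - Nrm u0) ≤ (P + Q) *ᵥ fun i => Nrm (y i) - Nrm u0 := fun i => by
    have h1 : Nrm (y i) ≤ (M⁻¹ *ᵥ fun _ => 1) i * Nrm u0
        + ((P + Q) *ᵥ fun j => Nrm (y j)) i := by
      nth_rewrite 1 [hrep i]
      refine (map_add_le_add Nrm _ _).trans ?_
      rw [add_mulVec, Pi.add_apply, ← add_assoc]
      refine add_le_add ((map_add_le_add Nrm _ _).trans (add_le_add ?_ ?_)) ?_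
      · rw [map_smul_eq_mul, Real.norm_of_nonneg (hcond1 i)]
      · exact Nrm.sum_smul_le (hPnn i) ha
      · exact Nrm.sum_smul_le (hQnn i) hd
    have h2 : ((P + Q) *ᵥ fun _ => Nrm u0) i = Nrm u0 - (M⁻¹ *ᵥ fun _ => 1) i * Nrm u0 := by
      rw [hPQ, sub_mulVec, one_mulVec]
      simp [mulVec, dotProduct, Finset.sum_mul]
    change _ ≤ ((P + Q) *ᵥ ((fun j => Nrm (y j)) - fun _ => Nrm u0)) i
    rw [mulVec_sub, Pi.sub_apply, h2]
    linarith
  have hz := nonpos_of_le_mulVec (P + Q) (fun i j => add_nonneg (hPnn i j) (hQnn i j))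
    (fun i => by
      rw [hPQ, sub_mulVec, one_mulVec]
      exact sub_le_self _ (hcond1 i))
    (fun w hw => by
      rw [hPQ, sub_mulVec, one_mulVec, sub_eq_self] at hw
      rw [← one_mulVec w, ← hinv', ← mulVec_mulVec, hw, mulVec_zero])
    hle
  exact sub_nonpos.1 (hz (Fin.last s))
end

section
/- Let s ≥ 1, let A, Ȧ be s×s real matrices, b, ḃ ∈ ℝˢ, and define the (s+1)×(s+1) matrices S = [[A, 0],[bᵀ, 0]] and Ṡ = [[Ȧ, 0],[ḃᵀ, 0]]. Suppose r > 0 and κ > 0 are such that the matrix M = I + r·S + (2r²/κ²)·(1−κ)·Ṡ is invertible and the entrywise inequalities M⁻¹·e ≥ 0 (e the all-ones vector), r·M⁻¹·(S − (2r/κ)·Ṡ) ≥ 0, and (2r²/κ²)·M⁻¹·Ṡ ≥ 0 hold. Let F : E → E satisfy the forward Euler condition with constant Δt_FE > 0 and suppose F, Ḟ satisfy the Taylor series condition with constant κ. Then for every u⁰ ∈ E, every Δt with 0 ≤ Δt ≤ r·Δt_FE, and every family y₁, …, y_{s+1} ∈ E satisfying the stage equations y_i = u⁰ + Δt·Σ_{j=1}^{s+1}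 S_{ij}·F(y_j) + Δt²·Σ_{j=1}^{s+1} Ṡ_{ij}·Ḟ(y_j), the update u¹ = y_{s+1} satisfies ‖u¹‖ ≤ ‖u⁰‖. -/
open Matrix

/-- The matrix `M = I + r·S + (2r²/κ²)·(1−κ)·Ṡ`. -/
noncomputable def sspMatTS {s : ℕ} (A Adot : Matrix (Fin s) (Fin s) ℝ)
    (b bdot : Fin s → ℝ) (r κ : ℝ) : Matrix (Fin (s + 1)) (Fin (s + 1)) ℝ :=
  1 + r • borderMat A b + ((2 * r ^ 2 / κ ^ 2) * (1 - κ)) • borderMat Adot bdot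

open scoped Matrix.Module

/-- If `K` is entrywise nonnegative and row-substochastic and `1 - K` is invertible, then
`x ≤ K x` forces `x ≤ 0`. -/
theorem nonpos_of_le_mulVec_of_substochastic {ι : Type*} [Fintype ι] [DecidableEq ι]
    {K M : Matrix ι ι ℝ} (hK : ∀ i j, 0 ≤ K i j) (hK1 : ∀ i, ∑ j, K i j ≤ 1)
    (hKM : (1 - K) * M = 1) {x : ι → ℝ} (hx : ∀ i, x i ≤ ∑ j, K i j * x j) (i : ι) :
    x i ≤ 0 := by
  obtain ⟨v, hv⟩ : ∃ v : ι → ℝ, ∀ i, v i = ∑ j, K i j * v j + 1 := by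
    refine ⟨M *ᵥ fun _ => 1, fun i => ?_⟩
    have h : (1 - K) *ᵥ (M *ᵥ fun _ => (1 : ℝ)) = fun _ => 1 := by
      rw [mulVec_mulVec, hKM, one_mulVec]
    have hi := congrFun h i
    rw [sub_mulVec, one_mulVec, Pi.sub_apply] at hi
    change _ = (K *ᵥ (M *ᵥ fun _ => (1 : ℝ))) i + 1
    linarith
  have hne : (Finset.univ : Finset ι).Nonempty := ⟨i, Finset.mem_univ i⟩
  have hv_nonneg : ∀ j, 0 ≤ v j := by
    obtain ⟨k, -, hk⟩ := Finset.exists_min_image Finset.univ v hne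
    have hle : (∑ j, K k j) * v k ≤ ∑ j, K k j * v j := by
      rw [Finset.sum_mul]
      exact Finset.sum_le_sum fun j hj => mul_le_mul_of_nonneg_left (hk j hj) (hK k j)
    have hk0 : 0 ≤ v k := by
      by_contra! hneg
      nlinarith [hv k, hK1 k]
    exact fun j => hk0.trans (hk j (Finset.mem_univ j))
  have hv_pos : ∀ j, 0 < v j := fun j => by
    rw [hv j]
    have := Finset.sum_nonneg fun k (_ : k ∈ Finset.univ) => mul_nonneg (hK j k) (hv_nonneg k)
    linarith
  obtain ⟨k, -, hk⟩ := Finset.exists_max_image Finset.univ (fun j => x j / v j) hne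
  have hxv : ∀ j, x j ≤ x k / v k * v j := fun j =>
    (div_le_iff₀ (hv_pos j)).1 (hk j (Finset.mem_univ j))
  have hle : ∑ j, K k j * x j ≤ x k / v k * ∑ j, K k j * v j := by
    rw [Finset.mul_sum]
    refine Finset.sum_le_sum fun j _ => ?_
    linarith [mul_le_mul_of_nonneg_left (hxv j) (hK k j)]
  have hratio : x k / v k ≤ 0 := by
    have hxk : x k = x k / v k * v k := (div_mul_cancel₀ _ (hv_pos k).ne').symm
    have hvk : ∑ j, K k j * v j = v k - 1 := by linarith [hv k]
    rw [hvk] at hle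
    linarith [hx k]
  exact (hxv i).trans (mul_nonpos_of_nonpos_of_nonneg hratio (hv_nonneg i))

theorem Seminorm.map_sum_smul_le {E ι : Type*} [AddCommGroup E] [Module ℝ E]
    (p : Seminorm ℝ E) (s : Finset ι) {c : ι → ℝ} {v : ι → E} {w : ι → ℝ}
    (hc : ∀ j ∈ s, 0 ≤ c j) (hvw : ∀ j ∈ s, p (v j) ≤ w j) :
    p (∑ j ∈ s, c j • v j) ≤ ∑ j ∈ s, c j * w j := by
  refine (Finset.le_sum_of_subadditive p (map_zero p).le (map_add_le_add p) s _).trans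
    (Finset.sum_le_sum fun j hj => ?_)
  rw [map_smul_eq_mul, Real.norm_of_nonneg (hc j hj)]
  exact mul_le_mul_of_nonneg_left (hvw j hj) (hc j hj)

theorem Matrix.Module.smul_real_smul {E ι : Type*} [AddCommGroup E] [Module ℝ E] [Fintype ι]
    [DecidableEq ι] (B : Matrix ι ι ℝ) (c : ℝ) (v : ι → E) : B • c • v = c • B • v := by
  ext i
  simp [Finset.smul_sum, smul_comm c]

/-- A vector-valued solution of `y = R u₀ + P a + Q c` with nonnegative coefficients `R = N 1`, `P`,
`Q`, where `N = 1 - (P + Q)` is invertible, is bounded by `u₀` as soon as `a` and `c` are bounded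
by `y`. -/
theorem Seminorm.le_of_eq_smul_add {E ι : Type*} [AddCommGroup E] [Module ℝ E] [Fintype ι]
    [DecidableEq ι] (p : Seminorm ℝ E) {M N P Q : Matrix ι ι ℝ} (hNM : N * M = 1)
    (hN : 1 - (P + Q) = N) (hN1 : ∀ i, 0 ≤ ∑ j, N i j) (hP : ∀ i j, 0 ≤ P i j)
    (hQ : ∀ i j, 0 ≤ Q i j) {u : E} {y a c : ι → E}
    (hy : y = N • (fun _ => u) + P • a + Q • c) (ha : ∀ j, p (a j) ≤ p (y j))
    (hc : ∀ j, p (c j) ≤ p (y j)) (i : ι) : p (y i) ≤ p u := by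
  have hsum : ∀ i, ∑ j, N i j = 1 - ∑ j, (P + Q) i j := fun i => by
    simp [← hN, Finset.sum_sub_distrib, Matrix.one_apply]
  refine sub_nonpos.1 (nonpos_of_le_mulVec_of_substochastic (K := P + Q) (M := M)
    (x := fun j => p (y j) - p u) (fun i j => add_nonneg (hP i j) (hQ i j))
    (fun i => by linarith [hN1 i, hsum i]) (by rw [hN, hNM]) (fun i => ?_) i)
  have hyi : y i = (∑ j, N i j) • u + ∑ j, P i j • a j + ∑ j, Q i j • c j := by
    rw [Finset.sum_smul]
    exact congrFun hy i
  have hle : p (y i) ≤ (∑ j, N i j) * p u + ∑ j, P i j * p (y j) + ∑ j, Q i j * p (y j) := by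
    rw [hyi]
    refine (map_add_le_add p _ _).trans (add_le_add ((map_add_le_add p _ _).trans
      (add_le_add ?_ ?_)) ?_)
    · rw [map_smul_eq_mul, Real.norm_of_nonneg (hN1 i)]
    · exact p.map_sum_smul_le _ (fun j _ => hP i j) fun j _ => ha j
    · exact p.map_sum_smul_le _ (fun j _ => hQ i j) fun j _ => hc j
  have hsplit : ∑ j, (P + Q) i j * (p (y j) - p u) =
      ∑ j, P i j * p (y j) + ∑ j, Q i j * p (y j) - (∑ j, (P + Q) i j) * p u := by
    simp only [mul_sub, Finset.sum_sub_distrib, ← Finset.sum_mul, Matrix.add_apply, add_mul,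
      Finset.sum_add_distrib]
  rw [hsplit]
  rw [hsum] at hle
  linarith

/-- Sufficient conditions for a two-derivative multistage method
to preserve the strong stability properties of the forward Euler condition and
the Taylor series condition (Theorem thmTS). -/
theorem ssp_two_derivative_rk_taylor_series_condition
    {E : Type*} [AddCommGroup E] [Module ℝ E] (Nrm : Seminorm ℝ E)
    (s : ℕ) (hs : 1 ≤ s)
    (A Adot : Matrix (Fin s) (Fin s) ℝ) (b bdot : Fin s → ℝ)
    (r κ dtFE : ℝ) (hr : 0 < r) (hκ : 0 < κ) (hdtFE : 0 < dtFE)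
    (hMinv : IsUnit (sspMatTS A Adot b bdot r κ))
    (hcond1 : ∀ i, 0 ≤ ((sspMatTS A Adot b bdot r κ)⁻¹ *ᵥ (fun _ => 1)) i)
    (hcond2 : ∀ i j,
      0 ≤ r * (((sspMatTS A Adot b bdot r κ)⁻¹ *
        (borderMat A b - (2 * r / κ) • borderMat Adot bdot)) i j))
    (hcond3 : ∀ i j,
      0 ≤ (2 * r ^ 2 / κ ^ 2) *
        (((sspMatTS A Adot b bdot r κ)⁻¹ * borderMat Adot bdot) i j))
    (F Fdot : E → E)
    (hFE : ∀ u : E, ∀ h : ℝ, 0 ≤ h → h ≤ dtFE → Nrm (u + h • F u) ≤ Nrm u)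
    (hTS : ∀ u : E, ∀ h : ℝ, 0 ≤ h → h ≤ κ * dtFE →
      Nrm (u + h • F u + (h ^ 2 / 2) • Fdot u) ≤ Nrm u)
    (u0 : E) (Δt : ℝ) (hΔt0 : 0 ≤ Δt) (hΔt : Δt ≤ r * dtFE)
    (y : Fin (s + 1) → E)
    (hy : ∀ i, y i = u0 + Δt • (∑ j, borderMat A b i j • F (y j))
        + Δt ^ 2 • (∑ j, borderMat Adot bdot i j • Fdot (y j))) :
    Nrm (y (Fin.last s)) ≤ Nrm u0 := by
  set S := borderMat A b
  set T := borderMat Adot bdot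
  set M := sspMatTS A Adot b bdot r κ with hM
  have hNM : M⁻¹ * M = 1 := nonsing_inv_mul _ ((isUnit_iff_isUnit_det _).1 hMinv)
  have hM' : M = 1 + (r • (S - (2 * r / κ) • T) + (2 * r ^ 2 / κ ^ 2) • T) := by
    rw [hM, sspMatTS]
    match_scalars <;> field_simp
    ring
  obtain ⟨h, rfl⟩ : ∃ h, Δt = r * h := ⟨Δt / r, by field_simp⟩
  have hh0 : 0 ≤ h := nonneg_of_mul_nonneg_right hΔt0 hr
  have hh : h ≤ dtFE := le_of_mul_le_mul_left hΔt hr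
  set f : Fin (s + 1) → E := fun j => F (y j)
  set g : Fin (s + 1) → E := fun j => Fdot (y j)
  set a : Fin (s + 1) → E := y + h • f
  set c : Fin (s + 1) → E := y + (κ * h) • f + ((κ * h) ^ 2 / 2) • g
  have hyv : y = (fun _ => u0) + (r * h) • S • f + (r * h) ^ 2 • T • g := funext hy
  have hMy : M • y = (fun _ => u0) + (r • (S - (2 * r / κ) • T)) • a +
      ((2 * r ^ 2 / κ ^ 2) • T) • c := by
    have hu : (fun _ => u0) = y - (r * h) • S • f - (r * h) ^ 2 • T • g := by
      nth_rewrite 1 [hyv]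
      abel
    rw [hM', hu]
    simp only [a, c, add_smul, sub_smul, smul_sub, one_smul, smul_assoc, smul_add,
      Matrix.Module.smul_real_smul]
    generalize S • y = Sy, T • y = Ty, S • f = Sf, T • f = Tf, T • g = Tg
    match_scalars <;> field_simp <;> ring
  refine Nrm.le_of_eq_smul_add (M := M) (N := M⁻¹)
    (P := r • (M⁻¹ * (S - (2 * r / κ) • T))) (Q := (2 * r ^ 2 / κ ^ 2) • (M⁻¹ * T))
    (a := a) (c := c) hNM ?_ (fun i => ?_) hcond2 hcond3 ?_
    (fun j => hFE (y j) h hh0 hh)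
    (fun j => hTS (y j) (κ * h) (by positivity) (by gcongr)) _
  · rw [sub_eq_iff_eq_add, ← Matrix.mul_smul, ← Matrix.mul_smul, ← mul_add]
    nth_rewrite 1 [← hNM]
    nth_rewrite 2 [hM']
    rw [mul_add, mul_one]
  · simpa [mulVec, dotProduct] using hcond1 i
  · rw [← Matrix.mul_smul, ← Matrix.mul_smul, mul_smul, mul_smul, ← smul_add, ← smul_add, ← hMy,
      ← mul_smul, hNM, one_smul]
end

section
/- Let F : E → E satisfy the forward Euler condition with some constant Δt_FE > 0 and let Ḟ : E → E satisfy the implicit negative derivative condition. Let s ≥ 1 and let real coefficients r_i, p_{ij} (1 ≤ j < i ≤ s), d_i, ḋ_i satisfy the consistency condition r_i + Σ_{j<i} p_{ij} = 1 for every i, together with r_i ≥ 0, p_{ij} ≥ 0, d_i ≥ 0, and ḋ_i ≤ 0. Then for every Δt > 0, every u⁰ ∈ E, and every family u⁽¹⁾, …, u⁽ˢ⁾ ∈ E satisfying the implicit stage equations u⁽ⁱ⁾ = r_i·u⁰ + Σ_{j<i} p_{ij}·u⁽ʲ⁾ + Δt·d_i·F(u⁽ⁱ⁾) + Δt²·ḋ_i·Ḟ(u⁽ⁱ⁾),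 the update u¹ = u⁽ˢ⁾ satisfies ‖u¹‖ ≤ ‖u⁰‖. -/
/-- Strong stability of a single implicit two-derivative stage: the forward Euler term is absorbed
by convexity and the second derivative term by the implicit negative derivative condition. -/
theorem Seminorm.le_of_implicit_two_derivative_stage
    {E : Type*} [AddCommGroup E] [Module ℝ E] (N : Seminorm ℝ E) {F G : E → E} {τ : ℝ}
    (hτ : 0 < τ) (hF : ∀ u : E, N (u + τ • F u) ≤ N u)
    (hG : ∀ h : ℝ, 0 < h → ∀ u v : E, v = u - h ^ 2 • G v → N v ≤ N u)
    {a b : ℝ} (ha : 0 ≤ a) (hb : b ≤ 0) {v w : E} (hv : v = w + a • F v + b • G v) :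
    N v ≤ N w := by
  obtain ⟨α, hα, rfl⟩ : ∃ α : ℝ, 0 ≤ α ∧ a = α * τ :=
    ⟨a / τ, by positivity, by field_simp⟩
  have hpos : 0 < 1 + α := by positivity
  set x : E := (1 + α)⁻¹ • (w + α • (v + τ • F v)) with hx
  have hvx : v = x + ((1 + α)⁻¹ * b) • G v := by
    have hscaled : (1 + α) • v = w + α • (v + τ • F v) + b • G v := by
      linear_combination (norm := module) hv
    rw [hx, mul_smul, ← smul_add, ← hscaled, inv_smul_smul₀ hpos.ne']
  have hNx : N v ≤ N x := by
    rcases hb.eq_or_lt with rfl | hb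
    · simp only [mul_zero, zero_smul, add_zero] at hvx
      exact (congrArg N hvx).le
    · have hc : 0 < (1 + α)⁻¹ * -b := mul_pos (inv_pos.mpr hpos) (neg_pos.mpr hb)
      refine hG √((1 + α)⁻¹ * -b) (Real.sqrt_pos.mpr hc) x v ?_
      rw [Real.sq_sqrt hc.le, mul_neg, neg_smul, sub_neg_eq_add]
      exact hvx
  have hscale : (1 + α) * N x ≤ N w + α * N v := by
    calc (1 + α) * N x = N (w + α • (v + τ • F v)) := by
          rw [hx, map_smul_eq_mul, Real.norm_of_nonneg (inv_nonneg.mpr hpos.le),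
            mul_inv_cancel_left₀ hpos.ne']
      _ ≤ N w + N (α • (v + τ • F v)) := map_add_le_add N _ _
      _ = N w + α * N (v + τ • F v) := by
          rw [map_smul_eq_mul, Real.norm_of_nonneg hα]
      _ ≤ N w + α * N v := by gcongr; exact hF v
  nlinarith [mul_le_mul_of_nonneg_left hNx hpos.le]

/-- Unconditional strong stability of implicit two-derivative
Runge--Kutta methods in Shu--Osher form with nonnegative coefficients on the
function and nonpositive coefficients on the second derivative
(Theorem thm:SSPMDRK). -/
theorem unconditional_ssp_implicit_two_derivative_rk
    {E : Type*} [AddCommGroup E] [Module ℝ E] (Nrm : Seminorm ℝ E)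
    (F Fdot : E → E) (dtFE : ℝ) (hdtFE : 0 < dtFE)
    (hFE : ∀ u : E, ∀ h : ℝ, 0 ≤ h → h ≤ dtFE → Nrm (u + h • F u) ≤ Nrm u)
    (hND : ∀ h : ℝ, 0 < h → ∀ u v : E, v = u - h ^ 2 • Fdot v → Nrm v ≤ Nrm u)
    (s : ℕ) (hs : 1 ≤ s)
    (rc : ℕ → ℝ) (p : ℕ → ℕ → ℝ) (d ddot : ℕ → ℝ)
    (hcons : ∀ i, 1 ≤ i → i ≤ s → rc i + ∑ j ∈ Finset.Ico 1 i, p i j = 1)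
    (hrc : ∀ i, 1 ≤ i → i ≤ s → 0 ≤ rc i)
    (hp : ∀ i j, 1 ≤ j → j < i → i ≤ s → 0 ≤ p i j)
    (hd : ∀ i, 1 ≤ i → i ≤ s → 0 ≤ d i)
    (hddot : ∀ i, 1 ≤ i → i ≤ s → ddot i ≤ 0)
    (Δt : ℝ) (hΔt : 0 < Δt) (u0 : E) (u : ℕ → E)
    (hu : ∀ i, 1 ≤ i → i ≤ s →
      u i = rc i • u0 + ∑ j ∈ Finset.Ico 1 i, p i j • u j
        + (Δt * d i) • F (u i) + (Δt ^ 2 * ddot i) • Fdot (u i)) :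
    Nrm (u s) ≤ Nrm u0 := by
  suffices h : ∀ i, 1 ≤ i → i ≤ s → Nrm (u i) ≤ Nrm u0 from h s hs le_rfl
  intro i
  induction i using Nat.strong_induction_on with
  | _ i ih =>
    intro hi his
    have hstage := Nrm.le_of_implicit_two_derivative_stage hdtFE
      (fun v => hFE v dtFE hdtFE.le le_rfl) hND (mul_nonneg hΔt.le (hd i hi his))
      (mul_nonpos_of_nonneg_of_nonpos (sq_nonneg Δt) (hddot i hi his)) (hu i hi his)
    calc Nrm (u i) ≤ Nrm (rc i • u0 + ∑ j ∈ Finset.Ico 1 i, p i j • u j) := hstage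
      _ ≤ Nrm (rc i • u0) + Nrm (∑ j ∈ Finset.Ico 1 i, p i j • u j) := map_add_le_add Nrm _ _
      _ ≤ rc i * Nrm u0 + ∑ j ∈ Finset.Ico 1 i, p i j * Nrm u0 := by
        refine add_le_add ?_ ((Finset.le_sum_of_subadditive Nrm (map_zero Nrm).le
          (map_add_le_add Nrm) _ _).trans (Finset.sum_le_sum fun j hj => ?_))
        · rw [map_smul_eq_mul, Real.norm_of_nonneg (hrc i hi his)]
        · obtain ⟨hj, hji⟩ := Finset.mem_Ico.mp hj
          have hpij := hp i j hj hji his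
          rw [map_smul_eq_mul, Real.norm_of_nonneg hpij]
          exact mul_le_mul_of_nonneg_left (ih j hji hj (hji.le.trans his)) hpij
      _ = Nrm u0 := by rw [← Finset.sum_mul, ← add_mul, hcons i hi his, one_mul]
end

section
/- Let Ḟ : E → E satisfy the explicit negative derivative condition with some constant Δt_ND > 0, i.e., ‖u − h²•Ḟ(u)‖ ≤ ‖u‖ for every u ∈ E and every real h with 0 ≤ h ≤ Δt_ND. Then Ḟ satisfies the implicit negative derivative condition: for every real h > 0 and all u, v ∈ E with v = u − h²•Ḟ(v), one has ‖v‖ ≤ ‖u‖. -/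
/-- The explicit negative derivative condition implies the
implicit negative derivative condition. -/
theorem explicit_neg_derivative_implies_implicit
    {E : Type*} [AddCommGroup E] [Module ℝ E] (Nrm : Seminorm ℝ E)
    (Fdot : E → E) (dtND : ℝ) (hdtND : 0 < dtND)
    (hEND : ∀ u : E, ∀ h : ℝ, 0 ≤ h → h ≤ dtND →
      Nrm (u - h ^ 2 • Fdot u) ≤ Nrm u) :
    ∀ h : ℝ, 0 < h → ∀ u v : E, v = u - h ^ 2 • Fdot v → Nrm v ≤ Nrm u := by
  intro h _ u v huv
  have hu : u = v + h ^ 2 • Fdot v := (sub_eq_iff_eq_add.mp huv.symm)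
  have hw : Nrm (v - dtND ^ 2 • Fdot v) ≤ Nrm v := hEND v dtND hdtND.le le_rfl
  -- `v` is a convex combination of `u` and the explicit step from `v`.
  have hcomb : (dtND ^ 2 + h ^ 2) • v =
      dtND ^ 2 • u + h ^ 2 • (v - dtND ^ 2 • Fdot v) := by
    rw [hu]
    module
  have hle : (dtND ^ 2 + h ^ 2) * Nrm v ≤ dtND ^ 2 * Nrm u + h ^ 2 * Nrm v := by
    calc (dtND ^ 2 + h ^ 2) * Nrm v
        = Nrm ((dtND ^ 2 + h ^ 2) • v) := by
          rw [map_smul_eq_mul, Real.norm_of_nonneg (by positivity)]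
      _ ≤ Nrm (dtND ^ 2 • u) + Nrm (h ^ 2 • (v - dtND ^ 2 • Fdot v)) := by
          rw [hcomb]
          exact map_add_le_add Nrm _ _
      _ = dtND ^ 2 * Nrm u + h ^ 2 * Nrm (v - dtND ^ 2 • Fdot v) := by
          rw [map_smul_eq_mul, map_smul_eq_mul, Real.norm_of_nonneg (sq_nonneg _),
            Real.norm_of_nonneg (sq_nonneg _)]
      _ ≤ dtND ^ 2 * Nrm u + h ^ 2 * Nrm v := by gcongr
  exact le_of_mul_le_mul_left (by linarith) (pow_pos hdtND 2)
end

section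
/- Let F : E → E satisfy the forward Euler condition with some constant Δt_FE > 0. Then the backward Euler method is unconditionally strongly stable: for every real Δt > 0 and all u, v ∈ E with v = u + Δt•F(v), one has ‖v‖ ≤ ‖u‖. -/
/-- The forward Euler condition implies that backward Euler is
unconditionally strongly stable. -/
theorem forward_euler_implies_backward_euler_unconditional_ssp
    {E : Type*} [AddCommGroup E] [Module ℝ E] (Nrm : Seminorm ℝ E)
    (F : E → E) (dtFE : ℝ) (hdtFE : 0 < dtFE)
    (hFE : ∀ u : E, ∀ h : ℝ, 0 ≤ h → h ≤ dtFE → Nrm (u + h • F u) ≤ Nrm u) :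
    ∀ Δt : ℝ, 0 < Δt → ∀ u v : E, v = u + Δt • F v → Nrm v ≤ Nrm u := by
  intro Δt hΔt u v hv
  have key : (dtFE + Δt) • v = dtFE • u + Δt • (v + dtFE • F v) := by
    have hu : u = v - Δt • F v := eq_sub_of_add_eq hv.symm
    rw [hu]
    module
  have hle := map_add_le_add Nrm (dtFE • u) (Δt • (v + dtFE • F v))
  rw [← key, map_smul_eq_mul, map_smul_eq_mul, map_smul_eq_mul, Real.norm_of_nonneg hdtFE.le,
    Real.norm_of_nonneg hΔt.le, Real.norm_of_nonneg (add_pos hdtFE hΔt).le] at hle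
  have hstep := mul_le_mul_of_nonneg_left (hFE v dtFE hdtFE.le le_rfl) hΔt.le
  exact le_of_mul_le_mul_left (by linarith) hdtFE
end

section
/- Let F : E → E satisfy the forward Euler condition with constant Δt_FE > 0 and let Ḟ : E → E satisfy the second derivative condition with constant K·Δt_FE, where K > 0. Then the explicit Taylor series method is strongly stable with SSP coefficient C = K·√(2 + K²) − K²: for every u ∈ E and every Δt with 0 ≤ Δt ≤ ( K·√(2 + K²) − K² )·Δt_FE, one has ‖u + Δt•F(u) + (Δt²/2)•Ḟ(u)‖ ≤ ‖u‖. -/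
/-- The explicit Taylor series method is SSP with coefficient
`C = K·√(2 + K²) − K²` under the forward Euler and second derivative
conditions. -/
theorem ssp_explicit_taylor_series_method
    {E : Type*} [AddCommGroup E] [Module ℝ E] (Nrm : Seminorm ℝ E)
    (F Fdot : E → E) (dtFE K : ℝ) (hdtFE : 0 < dtFE) (hK : 0 < K)
    (hFE : ∀ u : E, ∀ h : ℝ, 0 ≤ h → h ≤ dtFE → Nrm (u + h • F u) ≤ Nrm u)
    (hSD : ∀ u : E, ∀ h : ℝ, 0 ≤ h → h ≤ K * dtFE →
      Nrm (u + h ^ 2 • Fdot u) ≤ Nrm u) :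
    ∀ u : E, ∀ Δt : ℝ, 0 ≤ Δt →
      Δt ≤ (K * Real.sqrt (2 + K ^ 2) - K ^ 2) * dtFE →
      Nrm (u + Δt • F u + (Δt ^ 2 / 2) • Fdot u) ≤ Nrm u := by
  intro u Δt h0 hC
  obtain ⟨r, rfl⟩ : ∃ r, Δt = r * dtFE := ⟨Δt / dtFE, by field_simp⟩
  have hr : 0 ≤ r := nonneg_of_mul_nonneg_left h0 hdtFE
  have hrC : r ≤ K * Real.sqrt (2 + K ^ 2) - K ^ 2 := le_of_mul_le_mul_right hC hdtFE
  have hsq : (K * Real.sqrt (2 + K ^ 2)) ^ 2 = K ^ 2 * (2 + K ^ 2) := by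
    rw [mul_pow, Real.sq_sqrt (by positivity)]
  have hquad : (r + K ^ 2) ^ 2 ≤ K ^ 2 * (2 + K ^ 2) := by
    rw [← hsq]
    exact pow_le_pow_left₀ (by positivity) (by linarith) 2
  set s := r ^ 2 / (2 * K ^ 2) with hs
  have hs0 : 0 ≤ s := by positivity
  have hsK : s * (2 * K ^ 2) = r ^ 2 := by rw [hs]; field_simp
  have hw : 0 ≤ 1 - r - s := by
    have hK2 : 0 < 2 * K ^ 2 := by positivity
    refine nonneg_of_mul_nonneg_left (b := 2 * K ^ 2) ?_ hK2
    linarith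
  have hcomb : u + (r * dtFE) • F u + ((r * dtFE) ^ 2 / 2) • Fdot u =
      r • (u + dtFE • F u) + s • (u + (K * dtFE) ^ 2 • Fdot u) + (1 - r - s) • u := by
    have hcoef : (r * dtFE) ^ 2 / 2 = s * (K * dtFE) ^ 2 := by
      rw [mul_pow, ← hsK]; ring
    rw [hcoef]
    module
  have hF := hFE u dtFE hdtFE.le le_rfl
  have hG := hSD u (K * dtFE) (by positivity) le_rfl
  rw [hcomb]
  calc
    _ ≤ Nrm (r • (u + dtFE • F u)) + Nrm (s • (u + (K * dtFE) ^ 2 • Fdot u))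
        + Nrm ((1 - r - s) • u) :=
      (map_add_le_add Nrm _ _).trans (by gcongr; exact map_add_le_add Nrm _ _)
    _ = r * Nrm (u + dtFE • F u) + s * Nrm (u + (K * dtFE) ^ 2 • Fdot u)
        + (1 - r - s) * Nrm u := by
      simp only [map_smul_eq_mul, Real.norm_of_nonneg hr, Real.norm_of_nonneg hs0,
        Real.norm_of_nonneg hw]
    _ ≤ r * Nrm u + s * Nrm u + (1 - r - s) * Nrm u := by gcongr
    _ = Nrm u := by ring
end

section
/- Let F : E → E satisfy the forward Euler condition with constant Δt_FE > 0 and let Ḟ : E → E satisfy the second derivative condition with constant K·Δt_FE, where K > 0. Suppose r > 0 satisfies r⁴ + 4K²r³ − 12K²r² − 24K⁴r + 24K⁴ = 0 together with 4rK² + r² ≤ 8K², r² ≤ 6K², and r ≤ 2K. Then the two-stage fourth-order two-derivative Runge–Kutta method defined for u⁰ ∈ E by y⁽¹⁾ = u⁰ + (Δt/2)•F(u⁰) + (Δt²/8)•Ḟ(u⁰) and u¹ = u⁰ + Δt•F(u⁰) + (Δt²/6)•( Ḟ(u⁰) + 2•Ḟ(y⁽¹⁾) ) satisfies ‖u¹‖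 ≤ ‖u⁰‖ for every Δt with 0 ≤ Δt ≤ r·Δt_FE. -/
/-- The seminorm of a combination with nonnegative coefficients of total weight one of four
vectors in a seminorm ball stays in that ball. -/
theorem seminorm_convex_combination_le {E : Type*} [AddCommGroup E] [Module ℝ E]
    (Nrm : Seminorm ℝ E) {a b c d M : ℝ} {w x y z : E}
    (ha : 0 ≤ a) (hb : 0 ≤ b) (hc : 0 ≤ c) (hd : 0 ≤ d) (habcd : a + b + c + d = 1)
    (hw : Nrm w ≤ M) (hx : Nrm x ≤ M) (hy : Nrm y ≤ M) (hz : Nrm z ≤ M) :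
    Nrm (a • w + b • x + c • y + d • z) ≤ M := by
  have smul_le {t : ℝ} (ht : 0 ≤ t) {v : E} (hv : Nrm v ≤ M) : Nrm (t • v) ≤ t * M := by
    rw [map_smul_eq_mul, Real.norm_of_nonneg ht]
    exact mul_le_mul_of_nonneg_left hv ht
  calc Nrm (a • w + b • x + c • y + d • z)
      ≤ Nrm (a • w) + Nrm (b • x) + Nrm (c • y) + Nrm (d • z) :=
        (map_add_le_add Nrm _ _).trans <| by
          gcongr
          exact (map_add_le_add Nrm _ _).trans <| by gcongr; exact map_add_le_add Nrm _ _
    _ ≤ a * M + b * M + c * M + d * M :=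
        add_le_add (add_le_add (add_le_add (smul_le ha hw) (smul_le hb hx)) (smul_le hc hy))
          (smul_le hd hz)
    _ = M := by rw [← add_mul, ← add_mul, ← add_mul, habcd, one_mul]

/-- The quartic determining the SSP coefficient is nonnegative to the left of an admissible
root. -/
theorem ssp_quartic_nonneg {K r s : ℝ} (hK : 0 < K) (hr : 0 < r)
    (hpoly : r ^ 4 + 4 * K ^ 2 * r ^ 3 - 12 * K ^ 2 * r ^ 2
      - 24 * K ^ 4 * r + 24 * K ^ 4 = 0)
    (hc1 : 4 * r * K ^ 2 + r ^ 2 ≤ 8 * K ^ 2) (hc2 : r ^ 2 ≤ 6 * K ^ 2) (hc3 : r ≤ 2 * K)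
    (hs : 0 ≤ s) (hsr : s ≤ r) :
    0 ≤ s ^ 4 + 4 * K ^ 2 * s ^ 3 - 12 * K ^ 2 * s ^ 2 - 24 * K ^ 4 * s + 24 * K ^ 4 := by
  have hK2 : 0 < K ^ 2 := by positivity
  have deriv_nonpos : 0 ≤ 24 * K ^ 4 + 24 * K ^ 2 * r - 12 * K ^ 2 * r ^ 2 - 4 * r ^ 3 := by
    rcases le_total K (2 / 3) with hK' | hK'
    · have h1 : r ^ 2 ≤ 4 * K ^ 2 := by nlinarith
      have h2 : 0 ≤ 6 * K ^ 2 + 2 * r - 3 * r ^ 2 := by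
        have := mul_nonneg hr.le (sub_nonneg.2 hK')
        have := mul_nonneg hr.le (sub_nonneg.2 hc3)
        nlinarith
      nlinarith [mul_nonneg hK2.le h2, mul_le_mul_of_nonneg_left h1 hr.le]
    · have h1 : 0 ≤ 6 * K ^ 2 - 2 * r + r ^ 2 := by nlinarith [sq_nonneg (r - 1)]
      nlinarith [mul_nonneg hK2.le h1, mul_le_mul_of_nonneg_left hc1 hr.le]
  have slope_zero : 0 ≤ 24 * K ^ 4 + 12 * K ^ 2 * r - 4 * K ^ 2 * r ^ 2 - r ^ 3 := by
    nlinarith [mul_le_mul_of_nonneg_left hc2 hK2.le, mul_pos hK2 hr]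
  have slope : 0 ≤ 24 * K ^ 4 + 12 * K ^ 2 * (r + s) - 4 * K ^ 2 * (r ^ 2 + r * s + s ^ 2)
      - (r + s) * (r ^ 2 + s ^ 2) := by
    have h1 : s ^ 2 ≤ r * s := by nlinarith
    have h2 : s ^ 3 ≤ r ^ 2 * s := by nlinarith [mul_nonneg hs hs]
    have h3 : 0 ≤ 24 * K ^ 4 + 12 * K ^ 2 * r - 4 * K ^ 2 * r ^ 2 - r ^ 3
        + s * (12 * K ^ 2 - 8 * K ^ 2 * r - 3 * r ^ 2) := by
      refine nonneg_of_mul_nonneg_right (a := r) ?_ hr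
      linear_combination mul_nonneg (sub_nonneg.2 hsr) slope_zero + mul_nonneg hs deriv_nonpos
    nlinarith [mul_le_mul_of_nonneg_left h1 hK2.le, mul_le_mul_of_nonneg_left h1 hr.le]
  linear_combination mul_nonneg (sub_nonneg.2 hsr) slope - hpoly

/-- SSP property of the unique two-stage fourth-order
two-derivative Runge--Kutta method, with SSP coefficient `r` given by a root
of `r⁴ + 4K²r³ − 12K²r² − 24K⁴r + 24K⁴` satisfying the positivity constraints
of the optimal Shu--Osher decomposition. -/
theorem ssp_two_stage_fourth_order_two_derivative_rk
    {E : Type*} [AddCommGroup E] [Module ℝ E] (Nrm : Seminorm ℝ E)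
    (F Fdot : E → E) (dtFE K : ℝ) (hdtFE : 0 < dtFE) (hK : 0 < K)
    (hFE : ∀ u : E, ∀ h : ℝ, 0 ≤ h → h ≤ dtFE → Nrm (u + h • F u) ≤ Nrm u)
    (hSD : ∀ u : E, ∀ h : ℝ, 0 ≤ h → h ≤ K * dtFE →
      Nrm (u + h ^ 2 • Fdot u) ≤ Nrm u)
    (r : ℝ) (hr : 0 < r)
    (hpoly : r ^ 4 + 4 * K ^ 2 * r ^ 3 - 12 * K ^ 2 * r ^ 2
      - 24 * K ^ 4 * r + 24 * K ^ 4 = 0)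
    (hc1 : 4 * r * K ^ 2 + r ^ 2 ≤ 8 * K ^ 2)
    (hc2 : r ^ 2 ≤ 6 * K ^ 2)
    (hc3 : r ≤ 2 * K)
    (u0 : E) (Δt : ℝ) (hΔt0 : 0 ≤ Δt) (hΔt : Δt ≤ r * dtFE)
    (y1 u1 : E)
    (hy1 : y1 = u0 + (Δt / 2) • F u0 + (Δt ^ 2 / 8) • Fdot u0)
    (hu1 : u1 = u0 + Δt • F u0 + (Δt ^ 2 / 6) • (Fdot u0 + (2 : ℝ) • Fdot y1)) :
    Nrm u1 ≤ Nrm u0 := by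
  obtain ⟨s, rfl⟩ : ∃ s, Δt = s * dtFE := ⟨Δt / dtFE, by field_simp⟩
  have hs : 0 ≤ s := nonneg_of_mul_nonneg_left hΔt0 hdtFE
  have hsr : s ≤ r := le_of_mul_le_mul_right hΔt hdtFE
  have hK2 : 0 < K ^ 2 := by positivity
  have hsr2 : s ^ 2 ≤ r ^ 2 := by gcongr
  have hEuler := hFE u0 dtFE hdtFE.le le_rfl
  have hSecond := fun u => hSD u (K * dtFE) (by positivity) le_rfl
  have hy1_le : Nrm y1 ≤ Nrm u0 := by
    have heq : y1 = (1 - s / 2 - s ^ 2 / (8 * K ^ 2)) • u0 + (s / 2) • (u0 + dtFE • F u0)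
        + (s ^ 2 / (8 * K ^ 2)) • (u0 + (K * dtFE) ^ 2 • Fdot u0) + (0 : ℝ) • u0 := by
      rw [hy1]
      match_scalars <;> field_simp <;> ring
    rw [heq]
    refine seminorm_convex_combination_le Nrm ?_ (by positivity) (by positivity) le_rfl (by ring)
      le_rfl hEuler (hSecond u0) le_rfl
    have hform : 1 - s / 2 - s ^ 2 / (8 * K ^ 2)
        = (8 * K ^ 2 - (4 * s * K ^ 2 + s ^ 2)) / (8 * K ^ 2) := by
      field_simp
      ring
    rw [hform]
    exact div_nonneg (by nlinarith) (by positivity)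
  have heq : u1 = ((s ^ 4 + 4 * K ^ 2 * s ^ 3 - 12 * K ^ 2 * s ^ 2 - 24 * K ^ 4 * s + 24 * K ^ 4)
        / (24 * K ^ 4)) • u0
      + (s * (6 * K ^ 2 - s ^ 2) / (6 * K ^ 2)) • (u0 + dtFE • F u0)
      + (s ^ 2 * (4 * K ^ 2 - s ^ 2) / (24 * K ^ 4)) • (u0 + (K * dtFE) ^ 2 • Fdot u0)
      + (s ^ 2 / (3 * K ^ 2)) • (y1 + (K * dtFE) ^ 2 • Fdot y1) := by
    rw [hu1]
    generalize Fdot y1 = v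
    rw [hy1]
    match_scalars <;> field_simp <;> ring
  rw [heq]
  refine seminorm_convex_combination_le Nrm ?_ ?_ ?_ (by positivity) (by field_simp; ring)
    le_rfl hEuler (hSecond u0) ((hSecond y1).trans hy1_le)
  · exact div_nonneg (ssp_quartic_nonneg hK hr hpoly hc1 hc2 hc3 hs hsr) (by positivity)
  · exact div_nonneg (mul_nonneg hs (by linarith)) (by positivity)
  · exact div_nonneg (mul_nonneg (sq_nonneg s) (by nlinarith)) (by positivity)
end

section
/- Let N ≥ 2 be an integer and Δx > 0. Define the first-order upwind operator F : (ZMod N → ℝ) → (ZMod N → ℝ) by F(u)(j) = (u(j+1) − u(j))/Δx. Then F is total variation diminishing under forward Euler steps: for every u : ZMod N → ℝ and every Δt with 0 ≤ Δt ≤ Δx, one has ‖u + Δt•F(u)‖_TV ≤ ‖u‖_TV. -/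
/-- The total variation seminorm of a periodic grid function `u : ZMod N → ℝ`:
`‖u‖_TV = Σ_j |u(j+1) − u(j)|`. -/
noncomputable def tvNorm {N : ℕ} [NeZero N] (u : ZMod N → ℝ) : ℝ :=
  ∑ j : ZMod N, |u (j + 1) - u j|

/-- The total variation seminorm is invariant under the unit shift. -/
theorem sum_abs_shift_eq_tvNorm {N : ℕ} [NeZero N] (u : ZMod N → ℝ) :
    ∑ j : ZMod N, |u (j + 1 + 1) - u (j + 1)| = tvNorm u :=
  Equiv.sum_comp (Equiv.addRight (1 : ZMod N)) fun j => |u (j + 1) - u j|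

/-- A convex combination of a periodic grid function and its shift has no larger
total variation. -/
theorem tvNorm_convex_shift_le {N : ℕ} [NeZero N] (u : ZMod N → ℝ) {c : ℝ}
    (hc₀ : 0 ≤ c) (hc₁ : c ≤ 1) :
    tvNorm (fun j => (1 - c) * u j + c * u (j + 1)) ≤ tvNorm u := by
  calc
    tvNorm (fun j => (1 - c) * u j + c * u (j + 1))
      ≤ ∑ j : ZMod N, ((1 - c) * |u (j + 1) - u j| + c * |u (j + 1 + 1) - u (j + 1)|) := by
        refine Finset.sum_le_sum fun j _ => ?_
        have h := abs_add_le ((1 - c) * (u (j + 1) - u j)) (c * (u (j + 1 + 1) - u (j + 1)))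
        rw [abs_mul, abs_mul, abs_of_nonneg (sub_nonneg.2 hc₁), abs_of_nonneg hc₀] at h
        refine le_of_eq_of_le (congrArg abs ?_) h
        ring
    _ = (1 - c) * tvNorm u + c * tvNorm u := by
        rw [Finset.sum_add_distrib, ← Finset.mul_sum, ← Finset.mul_sum,
          sum_abs_shift_eq_tvNorm, tvNorm]
    _ = tvNorm u := by ring

/-- The first-order upwind discretization of `U_t = U_x` is
total variation diminishing under forward Euler steps with `Δt ≤ Δx`. -/
theorem upwind_forward_euler_tvd
    (N : ℕ) [NeZero N] (hN : 2 ≤ N) (Δx : ℝ) (hΔx : 0 < Δx) :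
    ∀ u : ZMod N → ℝ, ∀ Δt : ℝ, 0 ≤ Δt → Δt ≤ Δx →
      tvNorm (fun j => u j + Δt * ((u (j + 1) - u j) / Δx)) ≤ tvNorm u := by
  intro u Δt h₀ h₁
  convert tvNorm_convex_shift_le u (div_nonneg h₀ hΔx.le) ((div_le_one hΔx).2 h₁) using 3 with j
  ring
end

section
/- Let N ≥ 2 be an integer and Δx > 0. Define the centered second-difference operator Ḟ : (ZMod N → ℝ) → (ZMod N → ℝ) by Ḟ(u)(j) = (u(j+1) − 2u(j) + u(j−1))/Δx². Then for every u : ZMod N → ℝ and every Δt with 0 ≤ Δt ≤ (√2/2)·Δx, one has ‖u + Δt²•Ḟ(u)‖_TV ≤ ‖u‖_TV. -/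
/-- Adding at most half of the centered second difference of a periodic grid function does not
increase the total variation. -/
theorem tvNorm_add_mul_second_difference_le {N : ℕ} [NeZero N] (u : ZMod N → ℝ) {c : ℝ}
    (hc₀ : 0 ≤ c) (hc : c ≤ 1 / 2) :
    tvNorm (fun j => u j + c * (u (j + 1) - 2 * u j + u (j - 1))) ≤ tvNorm u := by
  set d : ZMod N → ℝ := fun j => u (j + 1) - u j with hd
  have hright : ∑ j, |d (j + 1)| = ∑ j, |d j| :=
    Equiv.sum_comp (Equiv.addRight (1 : ZMod N)) fun j => |d j|
  have hleft : ∑ j, |d (j - 1)| = ∑ j, |d j| :=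
    Equiv.sum_comp (Equiv.subRight (1 : ZMod N)) fun j => |d j|
  have hpoint (j : ZMod N) :
      |(u (j + 1) + c * (u (j + 1 + 1) - 2 * u (j + 1) + u (j + 1 - 1)))
          - (u j + c * (u (j + 1) - 2 * u j + u (j - 1)))|
        ≤ (1 - 2 * c) * |d j| + c * |d (j + 1)| + c * |d (j - 1)| := by
    calc
      _ = |(1 - 2 * c) * d j + c * d (j + 1) + c * d (j - 1)| := by
        simp only [hd, add_sub_cancel_right, sub_add_cancel]
        ring_nf
      _ ≤ |(1 - 2 * c) * d j| + |c * d (j + 1)| + |c * d (j - 1)| := abs_add_three _ _ _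
      _ = _ := by
        rw [abs_mul, abs_mul, abs_mul, abs_of_nonneg hc₀,
          abs_of_nonneg (by linarith : 0 ≤ 1 - 2 * c)]
  calc
    _ ≤ ∑ j, ((1 - 2 * c) * |d j| + c * |d (j + 1)| + c * |d (j - 1)|) :=
      Finset.sum_le_sum fun j _ => hpoint j
    _ = ∑ j, |d j| := by
      rw [Finset.sum_add_distrib, Finset.sum_add_distrib, ← Finset.mul_sum, ← Finset.mul_sum,
        ← Finset.mul_sum, hright, hleft]
      ring

/-- The centered second-difference discretization satisfies the
second derivative TVD condition with `Δt ≤ (√2/2)·Δx`. -/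
theorem centered_second_difference_tvd
    (N : ℕ) [NeZero N] (hN : 2 ≤ N) (Δx : ℝ) (hΔx : 0 < Δx) :
    ∀ u : ZMod N → ℝ, ∀ Δt : ℝ, 0 ≤ Δt → Δt ≤ (Real.sqrt 2 / 2) * Δx →
      tvNorm (fun j => u j +
          Δt ^ 2 * ((u (j + 1) - 2 * u j + u (j - 1)) / Δx ^ 2)) ≤ tvNorm u := by
  intro u Δt h₀ h
  have hratio : Δt ^ 2 / Δx ^ 2 ≤ 1 / 2 := by
    rw [div_le_iff₀ (by positivity)]
    calc
      Δt ^ 2 ≤ (Real.sqrt 2 / 2 * Δx) ^ 2 := by gcongr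
      _ = 1 / 2 * Δx ^ 2 := by
        rw [mul_pow, div_pow, Real.sq_sqrt zero_le_two]
        norm_num
  simpa only [mul_div_assoc', div_mul_eq_mul_div] using
    tvNorm_add_mul_second_difference_le u (by positivity) hratio
end

section
/- Let N ≥ 2 be an integer and Δx > 0. Define F : (ZMod N → ℝ) → (ZMod N → ℝ) by F(u)(j) = (u(j+1) − u(j))/Δx, and define Ḟ by applying this differencing twice: Ḟ(u)(j) = (u(j+2) − 2u(j+1) + u(j))/Δx². Then the Taylor series step is total variation diminishing: for every u : ZMod N → ℝ and every Δt with 0 ≤ Δt ≤ Δx, one has ‖u + Δt•F(u) + (Δt²/2)•Ḟ(u)‖_TV ≤ ‖u‖_TV. -/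
/-- A nonnegative combination of translates of a periodic grid function with weights summing to at
most one does not increase the total variation. -/
theorem tvNorm_sum_translates_le {N : ℕ} [NeZero N] {ι : Type*} (s : Finset ι)
    (w : ι → ℝ) (k : ι → ZMod N) (hw : ∀ i ∈ s, 0 ≤ w i) (hsum : ∑ i ∈ s, w i ≤ 1)
    (u : ZMod N → ℝ) :
    tvNorm (fun j => ∑ i ∈ s, w i * u (j + k i)) ≤ tvNorm u := by
  have translate (a : ZMod N) : ∑ j, |u (j + 1 + a) - u (j + a)| = tvNorm u := by
    simp_rw [add_right_comm _ 1 a]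
    exact Equiv.sum_comp (Equiv.addRight a) fun j => |u (j + 1) - u j|
  have nonneg : 0 ≤ tvNorm u := Finset.sum_nonneg fun _ _ => abs_nonneg _
  calc tvNorm (fun j => ∑ i ∈ s, w i * u (j + k i))
      ≤ ∑ j, ∑ i ∈ s, w i * |u (j + 1 + k i) - u (j + k i)| := by
        refine Finset.sum_le_sum fun j _ => ?_
        rw [← Finset.sum_sub_distrib]
        refine (Finset.abs_sum_le_sum_abs _ _).trans (Finset.sum_le_sum fun i hi => ?_)
        rw [← mul_sub, abs_mul, abs_of_nonneg (hw i hi)]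
    _ = (∑ i ∈ s, w i) * tvNorm u := by
        rw [Finset.sum_comm, Finset.sum_mul]
        simp_rw [← Finset.mul_sum, translate]
    _ ≤ tvNorm u := mul_le_of_le_one_left nonneg hsum

/-- With the first-order upwind operator `F` and the second
derivative `Ḟ` obtained by applying the upwind differencing twice, the Taylor
series step is total variation diminishing for `Δt ≤ Δx`. -/
theorem upwind_taylor_series_step_tvd
    (N : ℕ) [NeZero N] (hN : 2 ≤ N) (Δx : ℝ) (hΔx : 0 < Δx) :
    ∀ u : ZMod N → ℝ, ∀ Δt : ℝ, 0 ≤ Δt → Δt ≤ Δx →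
      tvNorm (fun j => u j + Δt * ((u (j + 1) - u j) / Δx)
          + (Δt ^ 2 / 2) * ((u (j + 2) - 2 * u (j + 1) + u j) / Δx ^ 2))
        ≤ tvNorm u := by
  intro u Δt h0 h1
  obtain ⟨c, rfl⟩ : ∃ c, Δt = c * Δx := ⟨Δt / Δx, by field_simp⟩
  have hc0 : 0 ≤ c := nonneg_of_mul_nonneg_left h0 hΔx
  have hc1 : c ≤ 1 := by rwa [mul_le_iff_le_one_left hΔx] at h1
  have key := tvNorm_sum_translates_le Finset.univ ![1 - c + c ^ 2 / 2, c - c ^ 2, c ^ 2 / 2]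
    ![(0 : ZMod N), 1, 2]
    (by
      intro i _
      fin_cases i
      · simp; nlinarith
      · simp; nlinarith
      · simp; positivity)
    (by simp only [Fin.sum_univ_three, Matrix.cons_val]; linarith) u
  convert key using 3 with j
  simp only [Fin.sum_univ_three, Matrix.cons_val, add_zero]
  field_simp
  ring
end

section
/- Let F : E → E satisfy the forward Euler condition with constant Δt_FE > 0 and suppose F, Ḟ satisfy the Taylor series condition with constant κ ≥ 1. Then the three-stage fourth-order two-derivative method defined for u⁰ ∈ E by y⁽¹⁾ = u⁰, y⁽²⁾ = u⁰ + Δt•F(y⁽¹⁾) + (Δt²/2)•Ḟ(y⁽¹⁾), y⁽³⁾ = u⁰ + (Δt/27)•( 14•F(y⁽¹⁾) + 4•F(y⁽²⁾) ) + (2Δt²/27)•Ḟ(y⁽¹⁾), and u¹ = u⁰ + (Δt/48)•( 17•F(y⁽¹⁾) + 4•F(y⁽²⁾) + 27•F(y⁽³⁾) ) + (Δt²/24)•Ḟ(y⁽¹⁾) is strongly stable with SSP coefficient C = 1: for every Δt with 0 ≤ Δt ≤ Δt_FE, one has ‖u¹‖ ≤ ‖u⁰‖. -/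
/-- Closed balls of a seminorm are stable under three-term convex combinations. -/
theorem Seminorm.convexCombination_le {E : Type*} [AddCommGroup E] [Module ℝ E]
    (p : Seminorm ℝ E) {a b c r : ℝ} {x y z : E} (ha : 0 ≤ a) (hb : 0 ≤ b) (hc : 0 ≤ c)
    (habc : a + b + c = 1) (hx : p x ≤ r) (hy : p y ≤ r) (hz : p z ≤ r) :
    p (a • x + b • y + c • z) ≤ r := by
  calc p (a • x + b • y + c • z) ≤ p (a • x) + p (b • y) + p (c • z) :=
        (map_add_le_add p _ _).trans (by gcongr; exact map_add_le_add p _ _)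
    _ = a * p x + b * p y + c * p z := by
        simp only [map_smul_eq_mul, Real.norm_of_nonneg ha, Real.norm_of_nonneg hb,
          Real.norm_of_nonneg hc]
    _ ≤ a * r + b * r + c * r := by gcongr
    _ = r := by rw [← add_mul, ← add_mul, habc, one_mul]


/-- The three-stage fourth-order two-derivative method for
`κ ≥ 1` is SSP with coefficient `C = 1` under the forward Euler and Taylor
series conditions. -/
theorem ssp_three_stage_fourth_order_taylor_kappa_ge_one
    {E : Type*} [AddCommGroup E] [Module ℝ E] (Nrm : Seminorm ℝ E)
    (F Fdot : E → E) (dtFE κ : ℝ) (hdtFE : 0 < dtFE) (hκ : 1 ≤ κ)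
    (hFE : ∀ u : E, ∀ h : ℝ, 0 ≤ h → h ≤ dtFE → Nrm (u + h • F u) ≤ Nrm u)
    (hTS : ∀ u : E, ∀ h : ℝ, 0 ≤ h → h ≤ κ * dtFE →
      Nrm (u + h • F u + (h ^ 2 / 2) • Fdot u) ≤ Nrm u)
    (u0 : E) (Δt : ℝ) (hΔt0 : 0 ≤ Δt) (hΔt : Δt ≤ dtFE)
    (y1 y2 y3 u1 : E)
    (hy1 : y1 = u0)
    (hy2 : y2 = u0 + Δt • F y1 + (Δt ^ 2 / 2) • Fdot y1)
    (hy3 : y3 = u0 + (Δt / 27) • ((14 : ℝ) • F y1 + (4 : ℝ) • F y2)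
        + (2 * Δt ^ 2 / 27) • Fdot y1)
    (hu1 : u1 = u0 + (Δt / 48) • ((17 : ℝ) • F y1 + (4 : ℝ) • F y2
        + (27 : ℝ) • F y3) + (Δt ^ 2 / 24) • Fdot y1) :
    Nrm u1 ≤ Nrm u0 := by
  have hκΔt : Δt ≤ κ * dtFE := by nlinarith
  have hf1 : Nrm (u0 + Δt • F u0) ≤ Nrm u0 := hFE u0 Δt hΔt0 hΔt
  have hn2 : Nrm y2 ≤ Nrm u0 := by
    rw [hy2, hy1]
    exact hTS u0 Δt hΔt0 hκΔt
  have hf2 : Nrm (y2 + Δt • F y2) ≤ Nrm u0 := (hFE y2 Δt hΔt0 hΔt).trans hn2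
  have hn3 : Nrm y3 ≤ Nrm u0 := by
    have h : y3 = (4 / 27 : ℝ) • (y2 + Δt • F y2) + (10 / 27 : ℝ) • (u0 + Δt • F u0)
        + (13 / 27 : ℝ) • u0 := by
      generalize F y2 = f at hy3 ⊢
      subst hy1
      rw [hy3, hy2]
      module
    rw [h]
    exact Nrm.convexCombination_le (by norm_num) (by norm_num) (by norm_num) (by norm_num)
      hf2 hf1 le_rfl
  have hf3 : Nrm (y3 + Δt • F y3) ≤ Nrm u0 := (hFE y3 Δt hΔt0 hΔt).trans hn3
  have h : u1 = (27 / 48 : ℝ) • (y3 + Δt • F y3) + (3 / 48 : ℝ) • (u0 + Δt • F u0)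
      + (18 / 48 : ℝ) • u0 := by
    generalize F y3 = f at hu1 ⊢
    subst hy1
    rw [hu1, hy3]
    module
  rw [h]
  exact Nrm.convexCombination_le (by norm_num) (by norm_num) (by norm_num) (by norm_num)
    hf3 hf1 le_rfl
end

section
/- Let F : E → E satisfy the forward Euler condition with constant Δt_FE > 0, let 0 < κ ≤ 1, and suppose F, Ḟ satisfy the Taylor series condition with constant κ. Define the coefficients a₂₁ = (κ+1)/2, ȧ₂₁ = (κ+1)²/8, a₃₁ = (κ+1)(−κ³ − 2κ² + 14κ + 3)/(2(κ+2)³), a₃₂ = (κ+1)(κ−3)²/(2(κ+2)³), ȧ₃₁ = κ(−κ² + 2κ + 3)²/(8(κ+2)³), b₁ = (3κ⁵ − 9κ⁴ − 22κ³ + 30κ² + 21κ + 11)/(3(κ−3)²(κ+1)³), b₂ = 2κ/(3(κ+1)³), b₃ = 2(κ+2)³/(3(κ−3)²(κ+1)³), ḃ₁ = −(−3κ³ + 3κ² + κ + 1)/(6(κ−3)(κ+1)²). Then the three-stage fourth-order method defined for u⁰ ∈ E by y⁽¹⁾ = u⁰, y⁽²⁾ = u⁰ + a₂₁Δt•F(y⁽¹⁾)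 + ȧ₂₁Δt²•Ḟ(y⁽¹⁾), y⁽³⁾ = u⁰ + a₃₁Δt•F(y⁽¹⁾) + a₃₂Δt•F(y⁽²⁾) + ȧ₃₁Δt²•Ḟ(y⁽¹⁾), u¹ = u⁰ + b₁Δt•F(y⁽¹⁾) + b₂Δt•F(y⁽²⁾) + b₃Δt•F(y⁽³⁾) + ḃ₁Δt²•Ḟ(y⁽¹⁾) is strongly stable with SSP coefficient C = 2κ/(κ+1): for every Δt with 0 ≤ Δt ≤ (2κ/(κ+1))·Δt_FE, one has ‖u¹‖ ≤ ‖u⁰‖. -/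
/-- A seminorm bound passes to convex combinations of the base point and three further points. -/
theorem Seminorm.map_convexCombination_le {E : Type*} [AddCommGroup E] [Module ℝ E]
    (p : Seminorm ℝ E) {x y z w : E} {a b c M : ℝ}
    (hx : p x ≤ M) (hy : p y ≤ M) (hz : p z ≤ M) (hw : p w ≤ M)
    (ha : 0 ≤ a) (hb : 0 ≤ b) (hc : 0 ≤ c) (habc : a + b + c ≤ 1) :
    p ((1 - a - b - c) • x + a • y + b • z + c • w) ≤ M := by
  have hd : 0 ≤ 1 - a - b - c := by linarith
  have key (t : ℝ) (v : E) (ht : 0 ≤ t) (hv : p v ≤ M) : p (t • v) ≤ t * M := by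
    rw [map_smul_eq_mul, Real.norm_of_nonneg ht]
    exact mul_le_mul_of_nonneg_left hv ht
  have h₁ := map_add_le_add p ((1 - a - b - c) • x + a • y + b • z) (c • w)
  have h₂ := map_add_le_add p ((1 - a - b - c) • x + a • y) (b • z)
  have h₃ := map_add_le_add p ((1 - a - b - c) • x) (a • y)
  have hx' := key _ x hd hx
  have hy' := key _ y ha hy
  have hz' := key _ z hb hz
  have hw' := key _ w hc hw
  linarith

/-- The optimal family of three-stage fourth-order
two-derivative methods for `0 < κ ≤ 1` is SSP with coefficient
`C = 2κ/(κ+1)` under the forward Euler and Taylor series conditions. -/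
theorem ssp_three_stage_fourth_order_taylor_kappa_le_one
    {E : Type*} [AddCommGroup E] [Module ℝ E] (Nrm : Seminorm ℝ E)
    (F Fdot : E → E) (dtFE κ : ℝ) (hdtFE : 0 < dtFE)
    (hκ0 : 0 < κ) (hκ1 : κ ≤ 1)
    (hFE : ∀ u : E, ∀ h : ℝ, 0 ≤ h → h ≤ dtFE → Nrm (u + h • F u) ≤ Nrm u)
    (hTS : ∀ u : E, ∀ h : ℝ, 0 ≤ h → h ≤ κ * dtFE →
      Nrm (u + h • F u + (h ^ 2 / 2) • Fdot u) ≤ Nrm u)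
    (u0 : E) (Δt : ℝ) (hΔt0 : 0 ≤ Δt) (hΔt : Δt ≤ (2 * κ / (κ + 1)) * dtFE)
    (y1 y2 y3 u1 : E)
    (hy1 : y1 = u0)
    (hy2 : y2 = u0 + (((κ + 1) / 2) * Δt) • F y1
        + (((κ + 1) ^ 2 / 8) * Δt ^ 2) • Fdot y1)
    (hy3 : y3 = u0
        + (((κ + 1) * (-κ ^ 3 - 2 * κ ^ 2 + 14 * κ + 3) / (2 * (κ + 2) ^ 3)) * Δt)
            • F y1
        + (((κ + 1) * (κ - 3) ^ 2 / (2 * (κ + 2) ^ 3)) * Δt) • F y2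
        + ((κ * (-κ ^ 2 + 2 * κ + 3) ^ 2 / (8 * (κ + 2) ^ 3)) * Δt ^ 2)
            • Fdot y1)
    (hu1 : u1 = u0
        + (((3 * κ ^ 5 - 9 * κ ^ 4 - 22 * κ ^ 3 + 30 * κ ^ 2 + 21 * κ + 11) /
            (3 * (κ - 3) ^ 2 * (κ + 1) ^ 3)) * Δt) • F y1
        + ((2 * κ / (3 * (κ + 1) ^ 3)) * Δt) • F y2
        + ((2 * (κ + 2) ^ 3 / (3 * (κ - 3) ^ 2 * (κ + 1) ^ 3)) * Δt) • F y3
        + ((-(-3 * κ ^ 3 + 3 * κ ^ 2 + κ + 1) /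
            (6 * (κ - 3) * (κ + 1) ^ 2)) * Δt ^ 2) • Fdot y1) :
    Nrm u1 ≤ Nrm u0 := by
  subst y1
  have hpos : 0 < κ + 1 := by linarith
  have hpos2 : 0 < κ + 2 := by linarith
  have hpos3 : 0 < 3 - κ := by linarith
  have h_sq : κ ^ 2 ≤ 1 := pow_le_one₀ hκ0.le hκ1
  have h_cube : κ ^ 3 ≤ κ := by nlinarith
  have h_four : κ ^ 4 ≤ κ := by nlinarith [pow_pos hκ0 3]
  set τ : ℝ := (κ + 1) / (2 * κ) * Δt with hτ
  have hΔτ : Δt = 2 * κ / (κ + 1) * τ := by rw [hτ]; field_simp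
  have hτ0 : 0 ≤ τ := by positivity
  have hτ1 : τ ≤ dtFE := by
    have hC : 0 < 2 * κ / (κ + 1) := by positivity
    rw [hΔτ] at hΔt
    exact le_of_mul_le_mul_left hΔt hC
  clear_value τ
  subst hΔτ
  have hy2' : y2 = u0 + (κ * τ) • F u0 + ((κ * τ) ^ 2 / 2) • Fdot u0 := by
    rw [hy2]
    match_scalars <;> field_simp <;> ring
  have hn2 : Nrm y2 ≤ Nrm u0 := by
    rw [hy2']
    exact hTS u0 _ (by positivity) (mul_le_mul_of_nonneg_left hτ1 hκ0.le)
  have euler (v : E) (hv : Nrm v ≤ Nrm u0) : Nrm (v + τ • F v) ≤ Nrm u0 :=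
    (hFE v τ hτ0 hτ1).trans hv
  have hn3 : Nrm y3 ≤ Nrm u0 := by
    have hdecomp : y3 =
        (1 - κ * (-2 * κ ^ 3 + 4 * κ ^ 2 + 5 * κ + 3) / (κ + 2) ^ 3 - 0
          - κ * (3 - κ) ^ 2 / (κ + 2) ^ 3) • u0
        + (κ * (-2 * κ ^ 3 + 4 * κ ^ 2 + 5 * κ + 3) / (κ + 2) ^ 3) • (u0 + τ • F u0)
        + (0 : ℝ) • y2
        + (κ * (3 - κ) ^ 2 / (κ + 2) ^ 3) • (y2 + τ • F y2) := by
      rw [hy3]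
      generalize F y2 = f2
      rw [hy2']
      match_scalars <;> field_simp <;> ring
    rw [hdecomp]
    refine Nrm.map_convexCombination_le le_rfl (euler u0 le_rfl) hn2 (euler y2 hn2)
      ?_ le_rfl (by positivity) ?_
    · have : 0 ≤ -2 * κ ^ 3 + 4 * κ ^ 2 + 5 * κ + 3 := by nlinarith
      positivity
    · rw [add_zero, ← add_div, div_le_one (by positivity)]
      nlinarith [pow_pos hκ0 4]
  have hdecomp : u1 =
      (1 - 2 * κ * (3 * κ ^ 5 - 11 * κ ^ 4 - 6 * κ ^ 3 + 4 * κ ^ 2 + 11 * κ + 5)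
            / (3 * (3 - κ) ^ 2 * (κ + 1) ^ 4)
          - 4 * (3 - κ) * (1 + κ - 2 * κ ^ 3) / (3 * (3 - κ) ^ 2 * (κ + 1) ^ 4)
          - 4 * κ * (κ + 2) ^ 3 / (3 * (3 - κ) ^ 2 * (κ + 1) ^ 4)) • u0
      + (2 * κ * (3 * κ ^ 5 - 11 * κ ^ 4 - 6 * κ ^ 3 + 4 * κ ^ 2 + 11 * κ + 5)
            / (3 * (3 - κ) ^ 2 * (κ + 1) ^ 4)) • (u0 + τ • F u0)
      + (4 * (3 - κ) * (1 + κ - 2 * κ ^ 3) / (3 * (3 - κ) ^ 2 * (κ + 1) ^ 4)) • y2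
      + (4 * κ * (κ + 2) ^ 3 / (3 * (3 - κ) ^ 2 * (κ + 1) ^ 4)) • (y3 + τ • F y3) := by
    rw [hu1, show (κ - 3) ^ 2 = (3 - κ) ^ 2 by ring, show κ - 3 = -(3 - κ) by ring]
    generalize F y3 = f3
    rw [hy3]
    generalize F y2 = f2
    rw [hy2']
    match_scalars <;> field_simp <;> ring
  rw [hdecomp]
  refine Nrm.map_convexCombination_le le_rfl (euler u0 le_rfl) hn2 (euler y3 hn3)
    ?_ ?_ (by positivity) ?_
  · have : 0 ≤ 3 * κ ^ 5 - 11 * κ ^ 4 - 6 * κ ^ 3 + 4 * κ ^ 2 + 11 * κ + 5 := by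
      nlinarith [pow_pos hκ0 5, mul_nonneg (sq_nonneg κ) (sub_nonneg.2 hκ1)]
    positivity
  · have : 0 ≤ 1 + κ - 2 * κ ^ 3 := by linarith
    positivity
  · rw [← add_div, ← add_div, div_le_one (by positivity)]
    nlinarith [pow_pos hκ0 4]
end

section
/- Let F_ex : E → E satisfy the forward Euler condition with constant Δt_FE > 0, let F_im : E → E satisfy the unconditional backward Euler condition, and let Ḟ_im : E → E satisfy the implicit negative derivative condition. Then the three-stage second-order IMEX two-derivative Runge–Kutta method is SSP with coefficient 1: for every Δt with 0 < Δt ≤ Δt_FE, every u⁰ ∈ E, and all u⁽¹⁾, u⁽²⁾, u⁽³⁾ ∈ E satisfying u⁽¹⁾ = u⁰ + (Δt/2)•F_im(u⁽¹⁾), u⁽²⁾ = u⁽¹⁾ + Δt•F_ex(u⁽¹⁾) − (Δt²/2)•Ḟ_im(u⁽²⁾), and u⁽³⁾ = (1/2)•u⁽¹⁾ + (1/2)•( u⁽²⁾ + Δt•F_ex(u⁽²⁾) ) + (Δt/2)•F_im(u⁽³⁾), the update u¹ = u⁽³⁾ satisfies ‖u¹‖ ≤ ‖u⁰‖. -/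
/-- The three-stage second-order IMEX two-derivative
Runge--Kutta method is SSP with coefficient `1`: the time-step restriction
`Δt ≤ Δt_FE` comes only from the explicit operator. -/
theorem ssp_three_stage_second_order_imex_rk
    {E : Type*} [AddCommGroup E] [Module ℝ E] (Nrm : Seminorm ℝ E)
    (Fex Fim Fimdot : E → E) (dtFE : ℝ) (hdtFE : 0 < dtFE)
    (hFE : ∀ u : E, ∀ h : ℝ, 0 ≤ h → h ≤ dtFE → Nrm (u + h • Fex u) ≤ Nrm u)
    (hBE : ∀ h : ℝ, 0 < h → ∀ u v : E, v = u + h • Fim v → Nrm v ≤ Nrm u)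
    (hND : ∀ h : ℝ, 0 < h → ∀ u v : E,
      v = u - h ^ 2 • Fimdot v → Nrm v ≤ Nrm u) :
    ∀ Δt : ℝ, 0 < Δt → Δt ≤ dtFE → ∀ u0 u1 u2 u3 : E,
      u1 = u0 + (Δt / 2) • Fim u1 →
      u2 = u1 + Δt • Fex u1 - (Δt ^ 2 / 2) • Fimdot u2 →
      u3 = (1 / 2 : ℝ) • u1 + (1 / 2 : ℝ) • (u2 + Δt • Fex u2)
        + (Δt / 2) • Fim u3 →
      Nrm u3 ≤ Nrm u0 := by
  intro Δt hpos hle u0 u1 u2 u3 e1 e2 e3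
  have b1 : Nrm u1 ≤ Nrm u0 := hBE (Δt / 2) (by positivity) u0 u1 e1
  have b2 : Nrm u2 ≤ Nrm (u1 + Δt • Fex u1) := by
    refine hND (Δt / √2) (by positivity) _ _ ?_
    rwa [div_pow, Real.sq_sqrt (by norm_num)]
  have b3 := hBE (Δt / 2) (by positivity) _ u3 e3
  have a1 := hFE u1 Δt hpos.le hle
  have a2 := hFE u2 Δt hpos.le hle
  have tri := map_add_le_add Nrm ((1 / 2 : ℝ) • u1) ((1 / 2 : ℝ) • (u2 + Δt • Fex u2))
  rw [map_smul_eq_mul, map_smul_eq_mul, Real.norm_of_nonneg (by norm_num)] at tri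
  linarith
end
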